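/- Let R be a local ring with maximal ideal m, and let (V,d) and (V',d') be minimal free multicomplexes of finite type. Then any weak multiequivalence f : (V,d) → (V',d') (a morphism of multicomplexes such that for each q the restriction F_q(CV) → F_q(CV') of its totalization induces an isomorphism on homology) is an isomorphism of multicomplexes, i.e., it admits a two-sided inverse morphism of multicomplexes under convolution composition. -/

import Mathlib

/-!
Framework: a bigraded `R`-module is a family `X : ℤ × ℤ → Type` of `R`-modules;
its total object is the direct sum `⨁ pq, X pq`.  A (column-filtration
preserving) multimorphism of degree `η` is a family `f : ℕ → _` of linear maps
of total objects, `f k` being the component of bidegree `(-k, k + η)`.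
-/

open scoped DirectSum

section MultiPreamble

variable {R : Type} [CommRing R]
variable {X Y Z : ℤ × ℤ → Type}
variable [∀ pq, AddCommGroup (X pq)] [∀ pq, Module R (X pq)]
variable [∀ pq, AddCommGroup (Y pq)] [∀ pq, Module R (Y pq)]
variable [∀ pq, AddCommGroup (Z pq)] [∀ pq, Module R (Z pq)]

/-- `F` maps the `(p,q)`-component of the total object into the `(p+a, q+b)`-component. -/
def IsBidegree (a b : ℤ) (F : (⨁ pq, X pq) →ₗ[R] ⨁ pq, Y pq) : Prop :=
  ∀ (pq : ℤ × ℤ) (x : X pq) (pq' : ℤ × ℤ), pq' ≠ (pq.1 + a, pq.2 + b) →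
    F (DirectSum.lof R (ℤ × ℤ) X pq x) pq' = 0

/-- Convolution composition of multimorphisms: `(g ∘ f)^k = ∑_{i+j=k} g^i f^j`. -/
def conv (g : ℕ → ((⨁ pq, Y pq) →ₗ[R] ⨁ pq, Z pq))
    (f : ℕ → ((⨁ pq, X pq) →ₗ[R] ⨁ pq, Y pq)) :
    ℕ → ((⨁ pq, X pq) →ₗ[R] ⨁ pq, Z pq) :=
  fun k => ∑ i ∈ Finset.range (k + 1), (g i).comp (f (k - i))

/-- The identity multimorphism. -/
def idmm (R : Type) [CommRing R] (X : ℤ × ℤ → Type) [∀ pq, AddCommGroup (X pq)]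
    [∀ pq, Module R (X pq)] : ℕ → ((⨁ pq, X pq) →ₗ[R] ⨁ pq, X pq) :=
  fun k => if k = 0 then LinearMap.id else 0

/-- Bounded below: for each total degree `n` the columns vanish far to the left. -/
def BoundedBelow (X : ℤ × ℤ → Type) [∀ pq, AddCommGroup (X pq)] : Prop :=
  ∀ n : ℤ, ∃ s : ℤ, ∀ pq : ℤ × ℤ, pq.1 + pq.2 = n → pq.1 < s → ∀ x : X pq, x = 0

/-- The bidegree-`(a,b)` component of a linear map of total objects. -/
noncomputable def component' (a b : ℤ) (F : (⨁ pq, X pq) →ₗ[R] ⨁ pq, Y pq) :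
    (⨁ pq, X pq) →ₗ[R] ⨁ pq, Y pq :=
  DirectSum.toModule R (ℤ × ℤ) _ fun pq =>
    (DirectSum.lof R (ℤ × ℤ) Y (pq.1 + a, pq.2 + b)).comp
      ((DirectSum.component R (ℤ × ℤ) Y (pq.1 + a, pq.2 + b)).comp
        (F.comp (DirectSum.lof R (ℤ × ℤ) X pq)))

/-- Totalization of a multimorphism (pointwise, a finite sum in each argument when
the modules are bounded below). -/
noncomputable def totalize (f : ℕ → ((⨁ pq, X pq) →ₗ[R] ⨁ pq, Y pq)) :
    (⨁ pq, X pq) → ⨁ pq, Y pq :=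
  fun x => ∑ᶠ k, f k x

/-- A multicomplex structure (multidifferential) on `X`. -/
def IsMulticomplex (d : ℕ → ((⨁ pq, X pq) →ₗ[R] ⨁ pq, X pq)) : Prop :=
  (∀ i : ℕ, IsBidegree (-(i : ℤ)) ((i : ℤ) - 1) (d i)) ∧
  ∀ n, ∑ i ∈ Finset.range (n + 1), (d i).comp (d (n - i)) = 0

/-- A morphism of multicomplexes. -/
def IsMCMorphism (dX : ℕ → ((⨁ pq, X pq) →ₗ[R] ⨁ pq, X pq))
    (dY : ℕ → ((⨁ pq, Y pq) →ₗ[R] ⨁ pq, Y pq))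
    (f : ℕ → ((⨁ pq, X pq) →ₗ[R] ⨁ pq, Y pq)) : Prop :=
  (∀ k : ℕ, IsBidegree (-(k : ℤ)) (k : ℤ) (f k)) ∧
  ∀ k, ∑ i ∈ Finset.range (k + 1), (dY i).comp (f (k - i)) =
    ∑ i ∈ Finset.range (k + 1), (f i).comp (dX (k - i))

/-- A multihomotopy from `φ` to `ψ`; `H k` encodes the component `h^{k-1}` (so that the
component `h^{-1}` is allowed). -/
def IsMultihomotopy (dX : ℕ → ((⨁ pq, X pq) →ₗ[R] ⨁ pq, X pq))
    (dY : ℕ → ((⨁ pq, Y pq) →ₗ[R] ⨁ pq, Y pq))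
    (φ ψ H : ℕ → ((⨁ pq, X pq) →ₗ[R] ⨁ pq, Y pq)) : Prop :=
  (∀ k : ℕ, IsBidegree (1 - (k : ℤ)) (k : ℤ) (H k)) ∧
  ∀ m, ∑ i ∈ Finset.range (m + 1), ((dY i).comp (H (m - i)) + (H i).comp (dX (m - i))) =
    if m = 0 then 0 else ψ (m - 1) - φ (m - 1)

/-- Lying in the `q`-th column filtration level of the total object. -/
def InColFil (q : ℤ) (x : ⨁ pq, X pq) : Prop := ∀ pq : ℤ × ℤ, q < pq.1 → x pq = 0

/-- The totalization of `f` restricts, on every column filtration level, to a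
homology isomorphism (a filtered quasi-isomorphism of total complexes). -/
def InducesColHomologyIso (dX : ℕ → ((⨁ pq, X pq) →ₗ[R] ⨁ pq, X pq))
    (dY : ℕ → ((⨁ pq, Y pq) →ₗ[R] ⨁ pq, Y pq))
    (f : ℕ → ((⨁ pq, X pq) →ₗ[R] ⨁ pq, Y pq)) : Prop :=
  ∀ q : ℤ,
    (∀ y : ⨁ pq, Y pq, InColFil q y → totalize dY y = 0 →
      ∃ (x : ⨁ pq, X pq) (z : ⨁ pq, Y pq), InColFil q x ∧ InColFil q z ∧
        totalize dX x = 0 ∧ y = totalize f x + totalize dY z) ∧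
    (∀ x : ⨁ pq, X pq, InColFil q x → totalize dX x = 0 →
      (∃ z : ⨁ pq, Y pq, InColFil q z ∧ totalize f x = totalize dY z) →
      ∃ w : ⨁ pq, X pq, InColFil q w ∧ x = totalize dX w)

end MultiPreamble

section MultimorphismLemmas

variable {R : Type} [CommRing R]
variable {X Y Z W : ℤ × ℤ → Type}
variable [∀ pq, AddCommGroup (X pq)] [∀ pq, Module R (X pq)]
variable [∀ pq, AddCommGroup (Y pq)] [∀ pq, Module R (Y pq)]
variable [∀ pq, AddCommGroup (Z pq)] [∀ pq, Module R (Z pq)]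
variable [∀ pq, AddCommGroup (W pq)] [∀ pq, Module R (W pq)]

theorem IsBidegree.apply_eq {a b : ℤ} {F : (⨁ pq, X pq) →ₗ[R] ⨁ pq, Y pq}
    (hF : IsBidegree a b F) (x : ⨁ pq, X pq) (pq : ℤ × ℤ) :
    F x pq = F (DirectSum.lof R (ℤ × ℤ) X (pq.1 - a, pq.2 - b) (x (pq.1 - a, pq.2 - b))) pq := by
  induction x using DirectSum.induction_on with
  | zero => simp
  | of rs x =>
    by_cases h : rs = (pq.1 - a, pq.2 - b)
    · subst h
      rw [← DirectSum.lof_eq_of R, DirectSum.lof_apply]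
    · rw [← DirectSum.lof_eq_of R, hF rs x pq]
      · rw [DirectSum.lof_eq_of R _ _ rs, DirectSum.of_eq_of_ne _ _ _ (Ne.symm h)]
        simp
      · rintro rfl
        simp at h
  | add x y hx hy =>
    simp only [map_add, DirectSum.add_apply, hx, hy]

theorem IsBidegree.apply_eq_self {F : (⨁ pq, X pq) →ₗ[R] ⨁ pq, Y pq}
    (hF : IsBidegree 0 0 F) (x : ⨁ pq, X pq) (pq : ℤ × ℤ) :
    F x pq = F (DirectSum.lof R (ℤ × ℤ) X pq (x pq)) pq := by
  have h (rs : ℤ × ℤ) (hrs : rs = (pq.1 - 0, pq.2 - 0)) :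
      F x pq = F (DirectSum.lof R (ℤ × ℤ) X rs (x rs)) pq := by
    subst hrs
    exact hF.apply_eq x pq
  exact h pq (by simp)

theorem IsBidegree.apply_eq_zero {a b : ℤ} {F : (⨁ pq, X pq) →ₗ[R] ⨁ pq, Y pq}
    (hF : IsBidegree a b F) {x : ⨁ pq, X pq} {pq : ℤ × ℤ}
    (hx : x (pq.1 - a, pq.2 - b) = 0) : F x pq = 0 := by
  rw [hF.apply_eq, hx]
  simp

theorem IsBidegree.comp {a b c d : ℤ} {G : (⨁ pq, Y pq) →ₗ[R] ⨁ pq, Z pq}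
    {F : (⨁ pq, X pq) →ₗ[R] ⨁ pq, Y pq} (hG : IsBidegree c d G) (hF : IsBidegree a b F) :
    IsBidegree (a + c) (b + d) (G.comp F) := by
  intro pq x rs hrs
  refine hG.apply_eq_zero (hF pq x _ ?_)
  rintro h
  rw [Prod.ext_iff] at h
  apply hrs
  ext <;> grind

theorem IsBidegree.sum {a b : ℤ} {ι : Type} {s : Finset ι}
    {F : ι → ((⨁ pq, X pq) →ₗ[R] ⨁ pq, Y pq)} (hF : ∀ i ∈ s, IsBidegree a b (F i)) :
    IsBidegree a b (∑ i ∈ s, F i) := by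
  intro pq x rs hrs
  rw [LinearMap.sum_apply, DirectSum.sum_apply]
  exact Finset.sum_eq_zero fun i hi => hF i hi pq x rs hrs

theorem IsBidegree.neg {a b : ℤ} {F : (⨁ pq, X pq) →ₗ[R] ⨁ pq, Y pq}
    (hF : IsBidegree a b F) : IsBidegree a b (-F) := by
  intro pq x rs hrs
  rw [LinearMap.neg_apply]
  exact (DFinsupp.neg_apply _ _).trans (neg_eq_zero.2 (hF pq x rs hrs))

theorem IsBidegree.symm {e : (⨁ pq, X pq) ≃ₗ[R] ⨁ pq, Y pq}
    (he : IsBidegree 0 0 e.toLinearMap) : IsBidegree 0 0 e.symm.toLinearMap := by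
  intro pq y rs hrs
  set u := e.symm (DirectSum.lof R (ℤ × ℤ) Y pq y) with hu
  have hrs' : rs ≠ pq := by simpa using hrs
  suffices h : DirectSum.lof R (ℤ × ℤ) X rs (u rs) = 0 by
    have := congrArg (fun v => v rs) h
    simpa [DirectSum.lof_apply] using this
  apply e.injective
  rw [map_zero]
  ext ab
  by_cases hab : ab = rs
  · subst hab
    have h := he.apply_eq_self u ab
    simp only [LinearEquiv.coe_coe] at h
    rw [← h, hu, e.apply_symm_apply, DirectSum.lof_eq_of, DirectSum.of_eq_of_ne _ _ _ hrs']
    rfl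
  · exact he rs (u rs) ab (by simpa using hab)

theorem conv_assoc (h : ℕ → ((⨁ pq, Z pq) →ₗ[R] ⨁ pq, W pq))
    (g : ℕ → ((⨁ pq, Y pq) →ₗ[R] ⨁ pq, Z pq)) (f : ℕ → ((⨁ pq, X pq) →ₗ[R] ⨁ pq, Y pq)) :
    conv (conv h g) f = conv h (conv g f) := by
  funext n
  have key := Finset.sum_range_diag_flip (n + 1) fun i j =>
    (h i).comp ((g j).comp (f (n - i - j)))
  simp only [conv]
  calc _ = ∑ m ∈ Finset.range (n + 1), ∑ k ∈ Finset.range (m + 1),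
        (h k).comp ((g (m - k)).comp (f (n - k - (m - k)))) := by
        refine Finset.sum_congr rfl fun m _ => ?_
        refine LinearMap.ext fun x => ?_
        simp only [LinearMap.comp_apply, LinearMap.sum_apply]
        refine Finset.sum_congr rfl fun k hk => ?_
        rw [show n - k - (m - k) = n - m by grind]
    _ = _ := by
        rw [key]
        refine Finset.sum_congr rfl fun i hi => ?_
        refine LinearMap.ext fun x => ?_
        simp only [LinearMap.comp_apply, LinearMap.sum_apply, map_sum]
        rw [show n + 1 - i = n - i + 1 by grind]

theorem conv_idmm (f : ℕ → ((⨁ pq, X pq) →ₗ[R] ⨁ pq, Y pq)) : conv f (idmm R X) = f := by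
  funext n
  rw [conv, Finset.sum_range_succ, Finset.sum_eq_zero]
  · simp [idmm]
  · intro i hi
    have : n - i ≠ 0 := by grind
    simp [idmm, this]

theorem idmm_conv (f : ℕ → ((⨁ pq, X pq) →ₗ[R] ⨁ pq, Y pq)) : conv (idmm R Y) f = f := by
  funext n
  rw [conv, Finset.sum_range_succ', Finset.sum_eq_zero]
  · simp [idmm]
  · intro i hi
    simp [idmm]

/-- The right inverse under convolution of a multimorphism with invertible leading term. -/
noncomputable def convInv (e : (⨁ pq, X pq) ≃ₗ[R] ⨁ pq, Y pq)
    (f : ℕ → ((⨁ pq, X pq) →ₗ[R] ⨁ pq, Y pq)) : ℕ → ((⨁ pq, Y pq) →ₗ[R] ⨁ pq, X pq)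
  | 0 => e.symm
  | n + 1 => -e.symm.toLinearMap.comp
      (∑ i : Fin (n + 1), (f (i + 1)).comp (convInv e f (n - i)))

theorem conv_convInv {e : (⨁ pq, X pq) ≃ₗ[R] ⨁ pq, Y pq}
    {f : ℕ → ((⨁ pq, X pq) →ₗ[R] ⨁ pq, Y pq)} (he : f 0 = e) :
    conv f (convInv e f) = idmm R Y := by
  funext n
  cases n with
  | zero =>
    ext1
    simp [conv, idmm, he, convInv]
  | succ n =>
    have h : ∑ i ∈ Finset.range (n + 1), (f (i + 1)).comp (convInv e f (n + 1 - (i + 1))) =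
        ∑ i : Fin (n + 1), (f (i + 1)).comp (convInv e f (n - i)) := by
      simp only [Nat.add_sub_add_right]
      exact Finset.sum_range fun i => (f (i + 1)).comp (convInv e f (n - i))
    rw [conv, Finset.sum_range_succ', h, he, Nat.sub_zero, convInv]
    ext1
    simp [idmm]

theorem convInv_conv {e : (⨁ pq, X pq) ≃ₗ[R] ⨁ pq, Y pq}
    {f : ℕ → ((⨁ pq, X pq) →ₗ[R] ⨁ pq, Y pq)} (he : f 0 = e) :
    conv (convInv e f) f = idmm R X := by
  set g := convInv e f with hg
  have hg0 : g 0 = e.symm.toLinearMap := by rw [hg, convInv]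
  have h1 : conv f g = idmm R Y := conv_convInv he
  have h2 : conv g (convInv e.symm g) = idmm R X := conv_convInv hg0
  have h3 : f = convInv e.symm g := by
    rw [← conv_idmm f, ← h2, ← conv_assoc, h1, idmm_conv]
  rw [← h2, ← h3]

theorem isBidegree_convInv {e : (⨁ pq, X pq) ≃ₗ[R] ⨁ pq, Y pq}
    {f : ℕ → ((⨁ pq, X pq) →ₗ[R] ⨁ pq, Y pq)} (he : f 0 = e)
    (hf : ∀ k : ℕ, IsBidegree (-(k : ℤ)) (k : ℤ) (f k)) (k : ℕ) :
    IsBidegree (-(k : ℤ)) (k : ℤ) (convInv e f k) := by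
  have hs : IsBidegree 0 0 e.symm.toLinearMap := by
    apply IsBidegree.symm
    simpa [he] using hf 0
  induction k using Nat.strong_induction_on with
  | _ k ih =>
    cases k with
    | zero => simpa [convInv] using hs
    | succ n =>
      rw [convInv]
      refine IsBidegree.neg ?_
      rw [← add_zero (-((n + 1 : ℕ) : ℤ)), ← add_zero (((n + 1 : ℕ) : ℤ))]
      refine hs.comp (IsBidegree.sum fun i _ => ?_)
      have := (hf (i + 1)).comp (ih (n - i) (by omega))
      convert this using 1 <;> grind

/-- A multimorphism of degree `η`: the `k`-th component has bidegree `(-k, k + η)`. -/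
def IsMultimorphism (η : ℤ) (F : ℕ → ((⨁ pq, X pq) →ₗ[R] ⨁ pq, Y pq)) : Prop :=
  ∀ k : ℕ, IsBidegree (-(k : ℤ)) (k + η) (F k)

theorem IsMultimorphism.exists_bound {η : ℤ} {F : ℕ → ((⨁ pq, X pq) →ₗ[R] ⨁ pq, Y pq)}
    (hF : IsMultimorphism η F) (hY : BoundedBelow Y) (x : ⨁ pq, X pq) :
    ∃ N, ∀ k ≥ N, F k x = 0 := by
  induction x using DirectSum.induction_on with
  | zero => exact ⟨0, by simp⟩
  | of pq x =>
    obtain ⟨s, hs⟩ := hY (pq.1 + pq.2 + η)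
    refine ⟨(pq.1 - s + 1).toNat, fun k hk => ?_⟩
    ext rs
    by_cases h : rs = (pq.1 + -(k : ℤ), pq.2 + (k + η))
    · subst h
      exact hs _ (by simp only; ring) (by simp only; omega) _
    · exact hF k pq x rs h
  | add x y hx hy =>
    obtain ⟨M, hM⟩ := hx
    obtain ⟨N, hN⟩ := hy
    exact ⟨max M N, fun k hk => by
      rw [map_add, hM k (le_trans (le_max_left _ _) hk), hN k (le_trans (le_max_right _ _) hk),
        add_zero]⟩

theorem totalize_eq_sum {F : ℕ → ((⨁ pq, X pq) →ₗ[R] ⨁ pq, Y pq)} {x : ⨁ pq, X pq} {N : ℕ}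
    (h : ∀ k ≥ N, F k x = 0) : totalize F x = ∑ k ∈ Finset.range N, F k x := by
  apply finsum_eq_sum_of_support_subset
  intro k hk
  by_contra hk'
  exact hk (h k (by simpa using hk'))

theorem IsMultimorphism.totalize_add {η : ℤ} {F : ℕ → ((⨁ pq, X pq) →ₗ[R] ⨁ pq, Y pq)}
    (hF : IsMultimorphism η F) (hY : BoundedBelow Y) (x y : ⨁ pq, X pq) :
    totalize F (x + y) = totalize F x + totalize F y := by
  obtain ⟨M, hM⟩ := hF.exists_bound hY x
  obtain ⟨N, hN⟩ := hF.exists_bound hY y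
  have hM' : ∀ k ≥ max M N, F k x = 0 := fun k hk => hM k (by omega)
  have hN' : ∀ k ≥ max M N, F k y = 0 := fun k hk => hN k (by omega)
  rw [totalize_eq_sum hM', totalize_eq_sum hN', totalize_eq_sum (N := max M N),
    ← Finset.sum_add_distrib]
  · simp
  · intro k hk
    rw [map_add, hM' k hk, hN' k hk, add_zero]

/-- The totalization of a multimorphism as an additive map. -/
noncomputable def IsMultimorphism.total {η : ℤ} {F : ℕ → ((⨁ pq, X pq) →ₗ[R] ⨁ pq, Y pq)}
    (hF : IsMultimorphism η F) (hY : BoundedBelow Y) : (⨁ pq, X pq) →+ ⨁ pq, Y pq :=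
  AddMonoidHom.mk' (totalize F) (hF.totalize_add hY)

theorem IsMultimorphism.total_apply {η : ℤ} {F : ℕ → ((⨁ pq, X pq) →ₗ[R] ⨁ pq, Y pq)}
    (hF : IsMultimorphism η F) (hY : BoundedBelow Y) (x : ⨁ pq, X pq) :
    hF.total hY x = totalize F x := rfl

theorem IsMultimorphism.totalize_totalize {η θ : ℤ}
    {G : ℕ → ((⨁ pq, Y pq) →ₗ[R] ⨁ pq, Z pq)} {F : ℕ → ((⨁ pq, X pq) →ₗ[R] ⨁ pq, Y pq)}
    (hG : IsMultimorphism θ G) (hF : IsMultimorphism η F) (hY : BoundedBelow Y)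
    (hZ : BoundedBelow Z) (x : ⨁ pq, X pq) :
    totalize G (totalize F x) = totalize (conv G F) x := by
  obtain ⟨N, hN⟩ := hF.exists_bound hY x
  choose b hb using fun j => hG.exists_bound hZ (F j x)
  set M := (Finset.range N).sup b with hMdef
  have hM : ∀ i ≥ M, ∀ j, G i (F j x) = 0 := by
    intro i hi j
    by_cases hj : j < N
    · exact hb j i (le_trans (Finset.le_sup (f := b) (Finset.mem_range.2 hj)) hi)
    · rw [hN j (by omega), map_zero]
  have hlhs : ∀ k ≥ M + N, G k (∑ j ∈ Finset.range N, F j x) = 0 := by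
    intro k hk
    rw [map_sum]
    exact Finset.sum_eq_zero fun j _ => hM k (by omega) j
  have hrhs : ∀ k ≥ M + N, conv G F k x = 0 := by
    intro k hk
    rw [conv, LinearMap.sum_apply]
    refine Finset.sum_eq_zero fun i _ => ?_
    rw [LinearMap.comp_apply]
    by_cases hi : M ≤ i
    · exact hM i hi _
    · rw [hN (k - i) (by omega), map_zero]
  rw [totalize_eq_sum hN, totalize_eq_sum hlhs, totalize_eq_sum hrhs]
  simp only [conv, LinearMap.sum_apply, LinearMap.comp_apply]
  rw [Finset.sum_range_diag_flip (M + N) fun i j => G i (F j x)]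
  refine Finset.sum_congr rfl fun i _ => ?_
  rw [map_sum]
  by_cases hi : M ≤ i
  · rw [Finset.sum_eq_zero fun j _ => hM i hi j, Finset.sum_eq_zero fun j _ => hM i hi j]
  · refine Finset.sum_subset (by grind) fun j _ hj => ?_
    rw [hN j (by simpa using hj), map_zero]

theorem InColFil.add {q : ℤ} {x y : ⨁ pq, X pq} (hx : InColFil q x) (hy : InColFil q y) :
    InColFil q (x + y) := fun pq h => by
  rw [DirectSum.add_apply, hx pq h, hy pq h, add_zero]

theorem InColFil.sub {q : ℤ} {x y : ⨁ pq, X pq} (hx : InColFil q x) (hy : InColFil q y) :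
    InColFil q (x - y) := fun pq h => by
  rw [DirectSum.sub_apply, hx pq h, hy pq h, sub_zero]

theorem InColFil.mono {q r : ℤ} (hqr : q ≤ r) {x : ⨁ pq, X pq} (hx : InColFil q x) :
    InColFil r x := fun pq h => hx pq (lt_of_le_of_lt hqr h)

theorem inColFil_lof (pq : ℤ × ℤ) (x : X pq) :
    InColFil pq.1 (DirectSum.lof R (ℤ × ℤ) X pq x) := by
  intro rs h
  rw [DirectSum.lof_eq_of, DirectSum.of_eq_of_ne]
  rintro rfl
  exact lt_irrefl _ h

theorem IsMultimorphism.apply_eq_zero {η : ℤ} {F : ℕ → ((⨁ pq, X pq) →ₗ[R] ⨁ pq, Y pq)}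
    (hF : IsMultimorphism η F) {q : ℤ} {x : ⨁ pq, X pq} (hx : InColFil q x) {k : ℕ}
    {pq : ℤ × ℤ} (h : q < pq.1 + k) : F k x pq = 0 :=
  (hF k).apply_eq_zero (hx _ (by simpa using h))

theorem IsMultimorphism.inColFil_totalize_sub {η : ℤ}
    {F : ℕ → ((⨁ pq, X pq) →ₗ[R] ⨁ pq, Y pq)} (hF : IsMultimorphism η F)
    (hY : BoundedBelow Y) {q : ℤ} {x : ⨁ pq, X pq} (hx : InColFil q x) :
    InColFil (q - 1) (totalize F x - F 0 x) := by
  obtain ⟨N, hN⟩ := hF.exists_bound hY x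
  have hN' : ∀ k ≥ N + 1, F k x = 0 := fun k hk => hN k (by omega)
  rw [totalize_eq_sum hN', Finset.sum_range_succ', add_sub_cancel_right]
  intro pq hpq
  rw [DirectSum.sum_apply]
  exact Finset.sum_eq_zero fun k _ => hF.apply_eq_zero hx (by push_cast; omega)

theorem IsMultimorphism.inColFil_totalize {η : ℤ}
    {F : ℕ → ((⨁ pq, X pq) →ₗ[R] ⨁ pq, Y pq)} (hF : IsMultimorphism η F)
    (hY : BoundedBelow Y) {q : ℤ} {x : ⨁ pq, X pq} (hx : InColFil q x) :
    InColFil q (totalize F x) := by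
  rw [← sub_add_cancel (totalize F x) (F 0 x)]
  exact ((hF.inColFil_totalize_sub hY hx).mono (by omega)).add
    fun pq hpq => hF.apply_eq_zero hx (by simpa using hpq)

theorem IsMultimorphism.inColFil_totalize_of_zero {η : ℤ}
    {F : ℕ → ((⨁ pq, X pq) →ₗ[R] ⨁ pq, Y pq)} (hF : IsMultimorphism η F)
    (hY : BoundedBelow Y) (h0 : F 0 = 0) {q : ℤ} {x : ⨁ pq, X pq} (hx : InColFil q x) :
    InColFil (q - 1) (totalize F x) := by
  simpa [h0] using hF.inColFil_totalize_sub hY hx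

theorem IsMulticomplex.isMultimorphism {d : ℕ → ((⨁ pq, X pq) →ₗ[R] ⨁ pq, X pq)}
    (hd : IsMulticomplex d) : IsMultimorphism (-1) d := hd.1

theorem IsMCMorphism.isMultimorphism {dX : ℕ → ((⨁ pq, X pq) →ₗ[R] ⨁ pq, X pq)}
    {dY : ℕ → ((⨁ pq, Y pq) →ₗ[R] ⨁ pq, Y pq)} {f : ℕ → ((⨁ pq, X pq) →ₗ[R] ⨁ pq, Y pq)}
    (hf : IsMCMorphism dX dY f) : IsMultimorphism 0 f := fun k => by
  simpa using hf.1 k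

theorem IsMulticomplex.totalize_totalize {d : ℕ → ((⨁ pq, X pq) →ₗ[R] ⨁ pq, X pq)}
    (hd : IsMulticomplex d) (hX : BoundedBelow X) (x : ⨁ pq, X pq) :
    totalize d (totalize d x) = 0 := by
  have h : conv d d = 0 := funext hd.2
  rw [hd.isMultimorphism.totalize_totalize hd.isMultimorphism hX hX, h]
  simp [totalize]

section Comparison

variable {dX : ℕ → ((⨁ pq, X pq) →ₗ[R] ⨁ pq, X pq)} {dY : ℕ → ((⨁ pq, Y pq) →ₗ[R] ⨁ pq, Y pq)}
  {f : ℕ → ((⨁ pq, X pq) →ₗ[R] ⨁ pq, Y pq)}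

theorem IsMCMorphism.conv_eq (hf : IsMCMorphism dX dY f) : conv dY f = conv f dX :=
  funext hf.2

theorem IsMCMorphism.totalize_comm (hf : IsMCMorphism dX dY f) (hX : IsMulticomplex dX)
    (hY : IsMulticomplex dY) (hbX : BoundedBelow X) (hbY : BoundedBelow Y) (x : ⨁ pq, X pq) :
    totalize dY (totalize f x) = totalize f (totalize dX x) := by
  rw [hY.isMultimorphism.totalize_totalize hf.isMultimorphism hbY hbY,
    hf.isMultimorphism.totalize_totalize hX.isMultimorphism hbX hbY, hf.conv_eq]

/-- Surjectivity on the associated graded pieces of the column filtration. -/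
theorem InducesColHomologyIso.exists_inColFil_sub (hf : IsMCMorphism dX dY f)
    (hX : IsMulticomplex dX) (hY : IsMulticomplex dY) (hbX : BoundedBelow X)
    (hbY : BoundedBelow Y) (hY0 : dY 0 = 0) (hw : InducesColHomologyIso dX dY f) {q : ℤ}
    {y : ⨁ pq, Y pq} (hy : InColFil q y) :
    ∃ x : ⨁ pq, X pq, InColFil q x ∧ InColFil (q - 1) (y - totalize f x) := by
  have lowY {z : ⨁ pq, Y pq} (hz : InColFil q z) : InColFil (q - 1) (totalize dY z) :=
    hY.isMultimorphism.inColFil_totalize_of_zero hbY hY0 hz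
  have addY := map_add (hY.isMultimorphism.total hbY)
  have subY := map_sub (hY.isMultimorphism.total hbY)
  have addf := map_add (hf.isMultimorphism.total hbY)
  simp only [IsMultimorphism.total_apply] at addY subY addf
  obtain ⟨x', z, hx', hz, hdx', e1⟩ :=
    (hw (q - 1)).1 (totalize dY y) (lowY hy) (hY.totalize_totalize hbY y)
  have hz' : InColFil q z := hz.mono (by omega)
  obtain ⟨w, hwq, rfl⟩ := (hw q).2 x' (hx'.mono (by omega)) hdx'
    ⟨y - z, hy.sub hz', by rw [subY, e1, add_sub_cancel_right]⟩
  obtain ⟨x'', z', hx'', hz'', -, e2⟩ := (hw q).1 (y - z - totalize f w)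
    ((hy.sub hz').sub (hf.isMultimorphism.inColFil_totalize hbY hwq))
    (by rw [subY, subY, e1, hf.totalize_comm hX hY hbX hbY]; abel)
  refine ⟨w + x'', hwq.add hx'', ?_⟩
  have : y - totalize f (w + x'') = z + totalize dY z' := by
    rw [addf, ← sub_eq_zero]
    rw [← sub_eq_zero] at e2
    rw [← e2]
    abel
  rw [this]
  exact hz.add (lowY hz'')

/-- Injectivity on the associated graded pieces of the column filtration. -/
theorem InducesColHomologyIso.inColFil_of_totalize (hf : IsMCMorphism dX dY f)
    (hX : IsMulticomplex dX) (hY : IsMulticomplex dY) (hbX : BoundedBelow X)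
    (hbY : BoundedBelow Y) (hX0 : dX 0 = 0) (hw : InducesColHomologyIso dX dY f) {q : ℤ}
    {x : ⨁ pq, X pq} (hx : InColFil q x) (hfx : InColFil (q - 1) (totalize f x)) :
    InColFil (q - 1) x := by
  have lowX {z : ⨁ pq, X pq} (hz : InColFil q z) : InColFil (q - 1) (totalize dX z) :=
    hX.isMultimorphism.inColFil_totalize_of_zero hbX hX0 hz
  have subX := map_sub (hX.isMultimorphism.total hbX)
  have subf := map_sub (hf.isMultimorphism.total hbY)
  have zerof := map_zero (hf.isMultimorphism.total hbY)
  simp only [IsMultimorphism.total_apply] at subX subf zerof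
  obtain ⟨w, hwq, e1⟩ := (hw (q - 1)).2 (totalize dX x) (lowX hx) (hX.totalize_totalize hbX x)
    ⟨totalize f x, hfx, (hf.totalize_comm hX hY hbX hbY x).symm⟩
  have hxw : totalize dX (x - w) = 0 := by rw [subX, e1, sub_self]
  obtain ⟨x', z, hx', hz, hdx', e2⟩ := (hw (q - 1)).1 (totalize f (x - w))
    (by rw [subf]; exact hfx.sub (hf.isMultimorphism.inColFil_totalize hbY hwq))
    (by rw [hf.totalize_comm hX hY hbX hbY, hxw, zerof])
  obtain ⟨w', hw', e3⟩ := (hw q).2 (x - w - x')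
    ((hx.sub (hwq.mono (by omega))).sub (hx'.mono (by omega)))
    (by rw [subX, hxw, hdx', sub_zero])
    ⟨z, hz.mono (by omega), by rw [subf, e2, add_sub_cancel_left]⟩
  have : x = totalize dX w' + x' + w := by rw [← e3]; abel
  rw [this]
  exact ((lowX hw').add hx').add hwq

theorem InducesColHomologyIso.bijective_zero (hf : IsMCMorphism dX dY f)
    (hX : IsMulticomplex dX) (hY : IsMulticomplex dY) (hbX : BoundedBelow X)
    (hbY : BoundedBelow Y) (hX0 : dX 0 = 0) (hY0 : dY 0 = 0)
    (hw : InducesColHomologyIso dX dY f) : Function.Bijective (f 0) := by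
  have hf0 : IsBidegree 0 0 (f 0) := by simpa using hf.1 0
  have lof_eq (pq : ℤ × ℤ) (x : X pq) : f 0 (DirectSum.lof R (ℤ × ℤ) X pq x) =
      DirectSum.lof R (ℤ × ℤ) Y pq (f 0 (DirectSum.lof R (ℤ × ℤ) X pq x) pq) := by
    ext rs
    by_cases h : rs = pq
    · subst h
      rw [DirectSum.lof_apply]
    · rw [hf0 pq x rs (by simpa using h), DirectSum.lof_eq_of, DirectSum.of_eq_of_ne _ _ _ h]
  constructor
  · rw [injective_iff_map_eq_zero]
    intro x hx
    ext pq
    set u := DirectSum.lof R (ℤ × ℤ) X pq (x pq) with hu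
    have hfu : f 0 u = 0 := by
      rw [hu, lof_eq, ← hf0.apply_eq_self, hx]
      simp
    have hup := inColFil_lof (R := R) pq (x pq)
    have h := hf.isMultimorphism.inColFil_totalize_sub hbY hup
    rw [← hu, hfu, sub_zero] at h
    have := hw.inColFil_of_totalize hf hX hY hbX hbY hX0 hup h pq (by omega)
    rwa [DirectSum.lof_apply] at this
  · intro y
    induction y using DirectSum.induction_on with
    | zero => exact ⟨0, map_zero _⟩
    | of pq y =>
      obtain ⟨x, hx, hxy⟩ := hw.exists_inColFil_sub hf hX hY hbX hbY hY0
        (inColFil_lof (R := R) pq y)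
      refine ⟨DirectSum.lof R (ℤ × ℤ) X pq (x pq), ?_⟩
      have h1 := hxy.add (hf.isMultimorphism.inColFil_totalize_sub hbY hx) pq (by omega)
      rw [sub_add_sub_cancel, DirectSum.sub_apply, DirectSum.lof_apply, sub_eq_zero] at h1
      rw [lof_eq, ← hf0.apply_eq_self, ← h1, DirectSum.lof_eq_of]
    | add y z hy hz =>
      obtain ⟨x, rfl⟩ := hy
      obtain ⟨x', rfl⟩ := hz
      exact ⟨x + x', map_add _ _ _⟩

theorem IsMCMorphism.exists_inverse (hf : IsMCMorphism dX dY f)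
    (hbij : Function.Bijective (f 0)) :
    ∃ g : ℕ → ((⨁ pq, Y pq) →ₗ[R] ⨁ pq, X pq),
      IsMCMorphism dY dX g ∧ conv f g = idmm R Y ∧ conv g f = idmm R X := by
  set e := LinearEquiv.ofBijective (f 0) hbij
  have he : f 0 = e.toLinearMap := by ext1; rfl
  have hfg := conv_convInv he
  have hgf := convInv_conv he
  refine ⟨convInv e f, ⟨isBidegree_convInv he hf.1, fun k => ?_⟩, hfg, hgf⟩
  have : conv dX (convInv e f) = conv (convInv e f) dY := by
    calc conv dX (convInv e f) = conv (conv (convInv e f) (conv f dX)) (convInv e f) := by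
          rw [← conv_assoc (convInv e f) f dX, hgf, idmm_conv]
      _ = conv (convInv e f) dY := by
          rw [← hf.conv_eq, conv_assoc, conv_assoc, hfg, conv_idmm]
  exact congrFun this k

end Comparison

end MultimorphismLemmas

/-- Proposition 3.4.  Over a local ring `R`, a weak multiequivalence
between minimal free multicomplexes of finite type is an isomorphism of multicomplexes
(it admits a two-sided inverse morphism of multicomplexes under convolution
composition).  Minimality means `d^0 = 0` and `d^1` takes values in `m·X`, where `m`
is the maximal ideal. -/
theorem minimal_multi_models_stmt13 (R : Type) [CommRing R] [IsLocalRing R]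
    (X Y : ℤ × ℤ → Type)
    [∀ pq, AddCommGroup (X pq)] [∀ pq, Module R (X pq)]
    [∀ pq, AddCommGroup (Y pq)] [∀ pq, Module R (Y pq)]
    [∀ pq, Module.Free R (X pq)] [∀ pq, Module.Free R (Y pq)]
    [∀ pq, Module.Finite R (X pq)] [∀ pq, Module.Finite R (Y pq)]
    (hftX : ∀ n : ℤ, {pq : ℤ × ℤ | pq.1 + pq.2 = n ∧ ∃ x : X pq, x ≠ 0}.Finite)
    (hftY : ∀ n : ℤ, {pq : ℤ × ℤ | pq.1 + pq.2 = n ∧ ∃ y : Y pq, y ≠ 0}.Finite)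
    (hbX : BoundedBelow X) (hbY : BoundedBelow Y)
    (dX : ℕ → ((⨁ pq, X pq) →ₗ[R] ⨁ pq, X pq))
    (dY : ℕ → ((⨁ pq, Y pq) →ₗ[R] ⨁ pq, Y pq))
    (hX : IsMulticomplex dX) (hY : IsMulticomplex dY)
    -- minimality of `X`:
    (hminX0 : dX 0 = 0)
    (hminX1 : ∀ (pq : ℤ × ℤ) (x : X pq),
      DirectSum.component R (ℤ × ℤ) X (pq.1 - 1, pq.2) (dX 1 (DirectSum.lof R (ℤ × ℤ) X pq x)) ∈
        (IsLocalRing.maximalIdeal R) • (⊤ : Submodule R (X (pq.1 - 1, pq.2))))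
    -- minimality of `Y`:
    (hminY0 : dY 0 = 0)
    (hminY1 : ∀ (pq : ℤ × ℤ) (y : Y pq),
      DirectSum.component R (ℤ × ℤ) Y (pq.1 - 1, pq.2) (dY 1 (DirectSum.lof R (ℤ × ℤ) Y pq y)) ∈
        (IsLocalRing.maximalIdeal R) • (⊤ : Submodule R (Y (pq.1 - 1, pq.2))))
    (f : ℕ → ((⨁ pq, X pq) →ₗ[R] ⨁ pq, Y pq))
    (hf : IsMCMorphism dX dY f)
    (hweak : InducesColHomologyIso dX dY f) :
    ∃ g : ℕ → ((⨁ pq, Y pq) →ₗ[R] ⨁ pq, X pq),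
      IsMCMorphism dY dX g ∧ conv f g = idmm R Y ∧ conv g f = idmm R X := by
  exact hf.exists_inverse (hweak.bijective_zero hf hX hY hbX hbY hminX0 hminY0)
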